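/- arXiv:2204.13896 — 4 statements merged into one kernel-verified Lean document; each statement's English description precedes it below -/
import Mathlib

section
/- Let Y = (Y_t, t ∈ ℕ) be a stationary stochastic process on a finite alphabet 𝒴. For a row-stochastic |𝒴|×|𝒴| matrix P̃, let X̃ be the Markov chain on 𝒴 with initial distribution p_{Y_1} and transition matrix P̃. Then the Kullback–Leibler divergence rate limsup_{T→∞} (1/T) D( p_{Y_1^T} ‖ p_{X̃_1^T} ) is minimized over all row-stochastic P̃ by taking P̃_{i,j} = P(Y_2 = j | Y_1 = i); i.e., for every row-stochastic matrix P̃' and with Q_{i,j} = P(Y_2 = j | Y_1 = i), limsup_{T→∞} (1/T) D( p_{Y_1^T} ‖ p_{X̃'_1^T} ) ≥ limsup_{T→∞} (1/T) D( p_{Y_1^T} ‖ p_{X̃_1^T} ), where X̃' and X̃ are the Markov chains with initial distribution p_{Y_1} and transition matrices P̃' and Q, respectively. -/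
open Classical

/-- A stationary stochastic process on a finite alphabet, given by its (consistent,
shift-invariant) finite-dimensional distributions `fd T = p_{Z_1^T}`. -/
structure StatProc (α : Type*) [Fintype α] where
  fd : (T : ℕ) → (Fin T → α) → ℝ
  nonneg : ∀ T x, 0 ≤ fd T x
  sum_one : ∀ T, ∑ x : Fin T → α, fd T x = 1
  consistent : ∀ T (x : Fin T → α), ∑ a : α, fd (T + 1) (Fin.snoc x a) = fd T x
  stationary : ∀ T (x : Fin T → α), ∑ a : α, fd (T + 1) (Fin.cons a x) = fd T x

/-- Finite-dimensional distributions of the Markov chain with initial distribution `μ`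
and transition matrix `P`: `p(x_1, …, x_T) = μ(x_1) ∏_{s=2}^T P_{x_{s-1}, x_s}`. -/
noncomputable def markovFD {α : Type*} [Fintype α] (μ : α → ℝ) (P : α → α → ℝ)
    (T : ℕ) (x : Fin T → α) : ℝ :=
  ∏ i : Fin T,
    if (i : ℕ) = 0 then μ (x i)
    else P (x ⟨(i : ℕ) - 1, lt_of_le_of_lt (Nat.sub_le _ _) i.isLt⟩) (x i)

/-- Kullback–Leibler divergence between finite PMFs, `+∞` in the absence of absolute
continuity (and `0 log 0 = 0`, as `Real.log 0 = 0`). -/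
noncomputable def klDiv {γ : Type*} [Fintype γ] (p q : γ → ℝ) : EReal :=
  if ∀ z, q z = 0 → p z = 0 then
    (((∑ z, p z * Real.log (p z / q z)) : ℝ) : EReal)
  else (⊤ : EReal)

/-- Kullback–Leibler divergence rate `limsup_{T→∞} (1/T) D(p_{Z_1^T} ‖ p_{Z̃_1^T})`. -/
noncomputable def klRate {α : Type*} [Fintype α]
    (pfd qfd : (T : ℕ) → (Fin T → α) → ℝ) : EReal :=
  Filter.limsup (fun T : ℕ => (((T : ℝ)⁻¹ : ℝ) : EReal) * klDiv (pfd T) (qfd T)) Filter.atTop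


/-- The law of a pair as the frozen statement writes it. -/
noncomputable def pairLaw {α : Type*} [Fintype α] (Y : StatProc α) (a b : α) : ℝ :=
  Y.fd 2 (fun k => if (k : ℕ) = 0 then a else b)

/-- Factors of the Markov law. -/
noncomputable def mkFac {α : Type*} [Fintype α] (μ : α → ℝ) (P : α → α → ℝ)
    (T : ℕ) (x : Fin T → α) (i : Fin T) : ℝ :=
  if (i : ℕ) = 0 then μ (x i)
    else P (x ⟨(i : ℕ) - 1, lt_of_le_of_lt (Nat.sub_le _ _) i.isLt⟩) (x i)

theorem sum_init {α : Type*} [Fintype α] (Y : StatProc α) (T : ℕ) (f : (Fin T → α) → ℝ) :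
    ∑ x : Fin (T + 1) → α, Y.fd (T + 1) x * f (fun i => x i.castSucc)
      = ∑ y : Fin T → α, Y.fd T y * f y := by
  rw [← (Fin.snocEquiv (fun _ : Fin (T + 1) => α)).sum_comp, Fintype.sum_prod_type_right]
  refine Finset.sum_congr rfl fun y _ => ?_
  rw [← Y.consistent T y, Finset.sum_mul]
  refine Finset.sum_congr rfl fun a _ => ?_
  simp [Fin.snocEquiv]

theorem sum_tail {α : Type*} [Fintype α] (Y : StatProc α) (T : ℕ) (f : (Fin T → α) → ℝ) :
    ∑ x : Fin (T + 1) → α, Y.fd (T + 1) x * f (fun i => x i.succ)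
      = ∑ y : Fin T → α, Y.fd T y * f y := by
  rw [← (Fin.consEquiv (fun _ : Fin (T + 1) => α)).sum_comp, Fintype.sum_prod_type_right]
  refine Finset.sum_congr rfl fun y _ => ?_
  rw [← Y.stationary T y, Finset.sum_mul]
  refine Finset.sum_congr rfl fun a _ => ?_
  simp [Fin.consEquiv]

theorem sum_pair {α : Type*} [Fintype α] (Y : StatProc α) (g : α → α → ℝ) (T : ℕ) :
    ∀ (i : ℕ) (h : i + 1 < T),
    ∑ x : Fin T → α, Y.fd T x * g (x ⟨i, by omega⟩) (x ⟨i + 1, h⟩)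
      = ∑ a, ∑ b, pairLaw Y a b * g a b := by
  induction T with
  | zero => intro i h; omega
  | succ n ih =>
    intro i h
    by_cases h1 : i + 1 < n
    · rw [← ih i h1]
      exact sum_init Y n (fun y => g (y ⟨i, by omega⟩) (y ⟨i + 1, h1⟩))
    · obtain rfl : n = i + 1 := by omega
      rcases i with _ | j
      · rw [← Fintype.sum_prod_type' (f := fun a b => pairLaw Y a b * g a b),
          ← (finTwoArrowEquiv α).sum_comp]
        refine Finset.sum_congr rfl fun x _ => ?_
        have : x = (fun k : Fin 2 => if (k : ℕ) = 0 then x 0 else x 1) := by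
          funext k; fin_cases k <;> simp
        change Y.fd 2 x * g (x 0) (x 1) =
          Y.fd 2 (fun k : Fin 2 => if (k : ℕ) = 0 then x 0 else x 1) * g (x 0) (x 1)
        rw [← this]
      · rw [← ih j (by omega)]
        exact sum_tail Y (j + 1 + 1) (fun y => g (y ⟨j, by omega⟩) (y ⟨j + 1, by omega⟩))

theorem pairLaw_nonneg {α : Type*} [Fintype α] (Y : StatProc α) (a b : α) :
    0 ≤ pairLaw Y a b := Y.nonneg _ _

theorem pairLaw_le {α : Type*} [Fintype α] (Y : StatProc α) (a b : α) :
    pairLaw Y a b ≤ Y.fd 1 (fun _ => a) := by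
  rw [← Y.consistent 1]
  have : pairLaw Y a b = Y.fd (1 + 1) (Fin.snoc (fun _ => a) b) := by
    unfold pairLaw
    congr 1
    funext k
    fin_cases k
    · simp [Fin.snoc]
    · simp [Fin.snoc]
  rw [this]
  exact Finset.single_le_sum (f := fun b => Y.fd (1 + 1) (Fin.snoc (fun _ => a) b))
    (fun c _ => Y.nonneg _ _) (Finset.mem_univ b)

theorem sum_fd_one {α : Type*} [Fintype α] (Y : StatProc α) :
    ∑ a, Y.fd 1 (fun _ => a) = 1 := by
  rw [← Y.sum_one 1, ← (Equiv.funUnique (Fin 1) α).symm.sum_comp]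
  rfl

theorem fd_le_pairLaw {α : Type*} [Fintype α] (Y : StatProc α) (T : ℕ) (x : Fin T → α)
    (i : ℕ) (h : i + 1 < T) :
    Y.fd T x ≤ pairLaw Y (x ⟨i, by omega⟩) (x ⟨i + 1, h⟩) := by
  have key := sum_pair Y (fun a b => if a = x ⟨i, by omega⟩ ∧ b = x ⟨i + 1, h⟩ then 1 else 0) T i h
  have h2 : ∑ a, ∑ b, pairLaw Y a b *
      (if a = x ⟨i, by omega⟩ ∧ b = x ⟨i + 1, h⟩ then (1 : ℝ) else 0)
      = pairLaw Y (x ⟨i, by omega⟩) (x ⟨i + 1, h⟩) := by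
    simp [ite_and]
  rw [← h2, ← key]
  refine le_trans ?_ (Finset.single_le_sum (fun c _ => ?_) (Finset.mem_univ x))
  · simp
  · refine mul_nonneg (Y.nonneg _ _) ?_
    split_ifs <;> norm_num

theorem sum_ratio {α : Type*} [Fintype α] (Y : StatProc α)
    (P' : α → α → ℝ) (hP'0 : ∀ i j, 0 ≤ P' i j) (hP'1 : ∀ i, ∑ j, P' i j = 1)
    (T i : ℕ) (h : i + 1 < T) :
    ∑ x : Fin T → α, Y.fd T x * (P' (x ⟨i, by omega⟩) (x ⟨i + 1, h⟩) /
      (pairLaw Y (x ⟨i, by omega⟩) (x ⟨i + 1, h⟩) / Y.fd 1 (fun _ => x ⟨i, by omega⟩))) ≤ 1 := by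
  rw [sum_pair Y (fun a b => P' a b / (pairLaw Y a b / Y.fd 1 (fun _ => a))) T i h]
  rw [← sum_fd_one Y]
  refine Finset.sum_le_sum fun a _ => ?_
  have hs : Y.fd 1 (fun _ => a) = ∑ b, Y.fd 1 (fun _ => a) * P' a b := by
    rw [← Finset.mul_sum, hP'1, mul_one]
  refine le_trans ?_ hs.ge
  refine Finset.sum_le_sum fun b _ => ?_
  rcases eq_or_ne (pairLaw Y a b) 0 with h0 | h0
  · rw [h0, zero_mul]
    exact mul_nonneg (Y.nonneg _ _) (hP'0 _ _)
  · rw [div_div_eq_mul_div, mul_div_cancel₀ _ h0, mul_comm]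

theorem klDiv_le_aux {α : Type*} [Fintype α] (Y : StatProc α)
    (P' : α → α → ℝ) (hP'0 : ∀ i j, 0 ≤ P' i j) (hP'1 : ∀ i, ∑ j, P' i j = 1) (T : ℕ) :
    klDiv (Y.fd T) (markovFD (fun a => Y.fd 1 (fun _ => a))
        (fun i j => pairLaw Y i j / Y.fd 1 (fun _ => i)) T) ≤
    klDiv (Y.fd T) (markovFD (fun a => Y.fd 1 (fun _ => a)) P' T) := by
  set μ : α → ℝ := fun a => Y.fd 1 (fun _ => a) with hμ
  set Q : α → α → ℝ := fun i j => pairLaw Y i j / Y.fd 1 (fun _ => i) with hQ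
  by_cases hac : ∀ z, markovFD μ P' T z = 0 → Y.fd T z = 0
  swap
  · have : klDiv (Y.fd T) (markovFD μ P' T) = ⊤ := if_neg hac
    rw [this]; exact le_top
  have hprod : ∀ R x, markovFD μ R T x = ∏ i, mkFac μ R T x i := fun _ _ => rfl
  have hPpos : ∀ x, Y.fd T x ≠ 0 → ∀ i, 0 < mkFac μ P' T x i := by
    intro x hx i
    have h1 : mkFac μ P' T x i ≠ 0 := by
      have := mt (hac x) hx
      rw [hprod] at this
      exact Finset.prod_ne_zero_iff.mp this i (Finset.mem_univ i)
    refine lt_of_le_of_ne ?_ h1.symm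
    unfold mkFac
    split_ifs
    · exact Y.nonneg _ _
    · exact hP'0 _ _
  have hQpos : ∀ x, Y.fd T x ≠ 0 → ∀ i, 0 < mkFac μ Q T x i := by
    intro x hx i
    have hP := hPpos x hx i
    have hx' : 0 < Y.fd T x := lt_of_le_of_ne (Y.nonneg _ _) hx.symm
    obtain ⟨i, hi⟩ := i
    rcases i with _ | i
    · exact hP
    · have h1 := fd_le_pairLaw Y T x i hi
      have h2 := pairLaw_le Y (x ⟨i, by omega⟩) (x ⟨i + 1, hi⟩)
      exact div_pos (hx'.trans_le h1) (hx'.trans_le (h1.trans h2))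
  have hacQ : ∀ z, markovFD μ Q T z = 0 → Y.fd T z = 0 := by
    intro z hz
    by_contra hne
    rw [hprod] at hz
    exact (Finset.prod_pos fun i _ => hQpos z hne i).ne' hz
  unfold klDiv
  rw [if_pos hac, if_pos hacQ, EReal.coe_le_coe_iff]
  have hpt : ∀ x, Y.fd T x * Real.log (Y.fd T x / markovFD μ Q T x) ≤
      Y.fd T x * Real.log (Y.fd T x / markovFD μ P' T x) +
      ∑ i, Y.fd T x * (mkFac μ P' T x i / mkFac μ Q T x i - 1) := by
    intro x
    rcases eq_or_ne (Y.fd T x) 0 with h0 | h0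
    · simp [h0]
    rw [← Finset.mul_sum, ← mul_add]
    refine mul_le_mul_of_nonneg_left ?_ (Y.nonneg _ _)
    rw [hprod, hprod, Real.log_div h0 (Finset.prod_pos fun i _ => hQpos x h0 i).ne',
      Real.log_div h0 (Finset.prod_pos fun i _ => hPpos x h0 i).ne',
      Real.log_prod fun i _ => (hQpos x h0 i).ne', Real.log_prod fun i _ => (hPpos x h0 i).ne']
    have : ∑ i, Real.log (mkFac μ P' T x i) - ∑ i, Real.log (mkFac μ Q T x i) ≤
        ∑ i, (mkFac μ P' T x i / mkFac μ Q T x i - 1) := by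
      rw [← Finset.sum_sub_distrib]
      refine Finset.sum_le_sum fun i _ => ?_
      rw [← Real.log_div (hPpos x h0 i).ne' (hQpos x h0 i).ne']
      exact Real.log_le_sub_one_of_pos (div_pos (hPpos x h0 i) (hQpos x h0 i))
    linarith
  refine (Finset.sum_le_sum fun x _ => hpt x).trans ?_
  rw [Finset.sum_add_distrib, Finset.sum_comm]
  have : ∑ i, ∑ x, Y.fd T x * (mkFac μ P' T x i / mkFac μ Q T x i - 1) ≤ 0 := by
    refine Finset.sum_nonpos fun i _ => ?_
    obtain ⟨i, hi⟩ := i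
    rcases i with _ | i
    · refine Finset.sum_nonpos fun x _ => ?_
      rcases eq_or_ne (Y.fd T x) 0 with h0 | h0
      · simp [h0]
      · have h1 : mkFac μ P' T x ⟨0, hi⟩ = mkFac μ Q T x ⟨0, hi⟩ := rfl
        rw [h1, div_self (hQpos x h0 _).ne']
        simp
    · simp only [mul_sub, mul_one, Finset.sum_sub_distrib, Y.sum_one]
      have := sum_ratio Y P' hP'0 hP'1 T i hi
      exact sub_nonpos.mpr this
  linarith

theorem one_step_transition_matrix_minimizes_KLDR
    {α : Type*} [Fintype α] (Y : StatProc α)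
    (P' : α → α → ℝ) (hP'0 : ∀ i j, 0 ≤ P' i j) (hP'1 : ∀ i, ∑ j, P' i j = 1) :
    klRate Y.fd (markovFD (fun a => Y.fd 1 (fun _ => a)) P') ≥
      klRate Y.fd (markovFD (fun a => Y.fd 1 (fun _ => a))
        (fun i j => Y.fd 2 (fun k => if (k : ℕ) = 0 then i else j) /
          Y.fd 1 (fun _ => i))) := by
  unfold klRate
  refine Filter.limsup_le_limsup (Filter.Eventually.of_forall fun T => ?_)
  refine mul_le_mul_of_nonneg_left (klDiv_le_aux Y P' hP'0 hP'1 T) ?_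
  exact EReal.coe_nonneg.mpr (by positivity)
end

section
/- Let (Y_X, Y_O) = ((Y_{X,t}, Y_{O,t}), t ∈ ℕ) be a jointly stationary stochastic process on a finite product alphabet 𝒳 × 𝒪. For a row-stochastic |𝒳|×|𝒳| matrix P̃ and a row-stochastic |𝒳|×|𝒪| matrix W, let (X̃', Õ) be the hidden Markov model in which X̃' is the Markov chain on 𝒳 with initial distribution p_{Y_{X,1}} and transition matrix P̃, and the Õ_t are conditionally independent given X̃' with P(Õ_t = i | X̃'_t = ℓ) = W_{ℓ,i}. Then the Kullback–Leibler divergence rate limsup_{T→∞} (1/T) D( p_{(Y_{X},Y_{O})_1^T} ‖ p_{(X̃',Õ)_1^T} ) over all such pairs (P̃, W) is minimized by the choice P̃_{ℓ,m} = P(Y_{X,2} = m | Y_{X,1} = ℓ) and W_{ℓ,i} = P(Y_{O,1} = i | Y_{X,1} = ℓ). -/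
open Classical

/-- Finite-dimensional distributions of the hidden Markov model with initial state
distribution `μ`, state transition matrix `P` and observation matrix `W`. -/
noncomputable def hmmFD {α β : Type*} [Fintype α] [Fintype β]
    (μ : α → ℝ) (P : α → α → ℝ) (W : α → β → ℝ) (T : ℕ) (z : Fin T → α × β) : ℝ :=
  markovFD μ P T (fun i => (z i).1) * ∏ i : Fin T, W (z i).1 (z i).2

theorem sum_fin_snoc {γ : Type*} [Fintype γ] (n : ℕ) (F : (Fin (n+1) → γ) → ℝ) :
    ∑ z, F z = ∑ x : Fin n → γ, ∑ a, F (Fin.snoc x a) := by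
  rw [← (Fin.snocEquiv (fun _ : Fin (n+1) => γ)).sum_comp, Fintype.sum_prod_type, Finset.sum_comm]
  rfl

theorem sum_fin_cons {γ : Type*} [Fintype γ] (n : ℕ) (F : (Fin (n+1) → γ) → ℝ) :
    ∑ z, F z = ∑ x : Fin n → γ, ∑ a, F (Fin.cons a x) := by
  rw [← (Fin.consEquiv (fun _ : Fin (n+1) => γ)).sum_comp, Fintype.sum_prod_type, Finset.sum_comm]
  rfl

theorem marg_one {γ : Type*} [Fintype γ] (Y : StatProc γ) (g : γ → ℝ) :
    ∀ n i (hi : i < n + 1), ∑ z : Fin (n+1) → γ, Y.fd (n+1) z * g (z ⟨i, hi⟩) =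
      ∑ w, Y.fd 1 (fun _ => w) * g w := by
  intro n
  induction n with
  | zero =>
    intro i hi
    obtain rfl : i = 0 := by omega
    rw [← (Equiv.funUnique (Fin 1) γ).symm.sum_comp]
    rfl
  | succ n ih =>
    intro i hi
    cases i with
    | zero =>
      rw [sum_fin_snoc, ← ih 0 (by omega)]
      refine Finset.sum_congr rfl fun x _ => ?_
      rw [← Y.consistent, Finset.sum_mul]
      refine Finset.sum_congr rfl fun a _ => ?_
      congr 2
    | succ i =>
      rw [sum_fin_cons, ← ih i (by omega)]
      refine Finset.sum_congr rfl fun x _ => ?_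
      rw [← Y.stationary, Finset.sum_mul]
      refine Finset.sum_congr rfl fun a _ => ?_
      congr 2

theorem marg_two {γ : Type*} [Fintype γ] (Y : StatProc γ) (g : γ → γ → ℝ) :
    ∀ n i (hi : i + 1 < n + 2),
      ∑ z : Fin (n+2) → γ, Y.fd (n+2) z * g (z ⟨i, by omega⟩) (z ⟨i+1, hi⟩) =
      ∑ w, ∑ v, Y.fd 2 (fun k => if (k : ℕ) = 0 then w else v) * g w v := by
  intro n
  induction n with
  | zero =>
    intro i hi
    obtain rfl : i = 0 := by omega
    rw [← (finTwoArrowEquiv γ).symm.sum_comp, Fintype.sum_prod_type]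
    refine Finset.sum_congr rfl fun x _ => Finset.sum_congr rfl fun y _ => ?_
    have : (finTwoArrowEquiv γ).symm (x, y) = (fun k : Fin 2 => if (k : ℕ) = 0 then x else y) := by
      funext k; fin_cases k <;> rfl
    rw [this]
    simp
  | succ n ih =>
    intro i hi
    cases i with
    | zero =>
      rw [sum_fin_snoc, ← ih 0 (by omega)]
      refine Finset.sum_congr rfl fun x _ => ?_
      rw [← Y.consistent, Finset.sum_mul]
      refine Finset.sum_congr rfl fun a _ => ?_
      congr 2
    | succ i =>
      rw [sum_fin_cons, ← ih i (by omega)]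
      refine Finset.sum_congr rfl fun x _ => ?_
      rw [← Y.stationary, Finset.sum_mul]
      refine Finset.sum_congr rfl fun a _ => ?_
      congr 2

section HMM
variable {α β : Type*} [Fintype α] [Fintype β]

theorem margX (Y : StatProc (α × β)) (R : α → β → ℝ) (T : ℕ) (i : Fin T) :
    ∑ z, Y.fd T z * R (z i).1 (z i).2 = ∑ a, ∑ b, Y.fd 1 (fun _ => (a, b)) * R a b := by
  obtain ⟨i, hi⟩ := i
  obtain ⟨n, rfl⟩ : ∃ n, T = n + 1 := ⟨T - 1, by omega⟩
  rw [marg_one Y (fun w => R w.1 w.2) n i hi, Fintype.sum_prod_type]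

theorem margXX (Y : StatProc (α × β)) (R : α → α → ℝ) (T : ℕ) (i : Fin T) (h : (i : ℕ) ≠ 0) :
    ∑ z, Y.fd T z *
      R (z ⟨(i : ℕ) - 1, lt_of_le_of_lt (Nat.sub_le _ _) i.isLt⟩).1 (z i).1 =
    ∑ a, ∑ c, (∑ o₁, ∑ o₂, Y.fd 2 (fun k => if (k : ℕ) = 0 then (a, o₁) else (c, o₂))) * R a c := by
  obtain ⟨i, hi⟩ := i
  obtain ⟨j, rfl⟩ : ∃ j, i = j + 1 := ⟨i - 1, by simp at h; omega⟩
  obtain ⟨n, rfl⟩ : ∃ n, T = n + 2 := ⟨T - 2, by omega⟩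
  have := marg_two Y (fun w v => R w.1 v.1) n j hi
  simp only [Nat.add_sub_cancel]
  rw [this, Fintype.sum_prod_type]
  refine Finset.sum_congr rfl fun a _ => ?_
  simp only [Fintype.sum_prod_type, Finset.sum_mul]
  rw [Finset.sum_comm]

theorem log_prod_sub_le {ι : Type*} [Fintype ι] (a b : ι → ℝ) (ha : ∀ i, 0 < a i)
    (hb : ∀ i, 0 < b i) :
    Real.log (∏ i, b i) - Real.log (∏ i, a i) ≤ ∑ i, (b i / a i - 1) := by
  rw [Real.log_prod (fun i _ => (hb i).ne'), Real.log_prod (fun i _ => (ha i).ne'),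
    ← Finset.sum_sub_distrib]
  refine Finset.sum_le_sum fun i _ => ?_
  rw [← Real.log_div (hb i).ne' (ha i).ne']
  exact Real.log_le_sub_one_of_pos (div_pos (hb i) (ha i))

theorem gibbs_term {N M P : ℝ} (hM : 0 ≤ M) (hP : 0 ≤ P) :
    N * (P / (N / M)) ≤ M * P := by
  by_cases h : N = 0
  · simp [h]; positivity
  by_cases h' : M = 0
  · simp [h']
  apply le_of_eq; field_simp

theorem kl_le (Y : StatProc (α × β))
    (P' : α → α → ℝ) (hP'0 : ∀ i j, 0 ≤ P' i j) (hP'1 : ∀ i, ∑ j, P' i j = 1)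
    (W' : α → β → ℝ) (hW'0 : ∀ i o, 0 ≤ W' i o) (hW'1 : ∀ i, ∑ o, W' i o = 1)
    (M : α → ℝ) (hM : M = fun a => ∑ b, Y.fd 1 (fun _ => (a, b)))
    (N : α → α → ℝ) (hN : N = fun ℓ m =>
      ∑ o₁, ∑ o₂, Y.fd 2 (fun k => if (k : ℕ) = 0 then (ℓ, o₁) else (m, o₂)))
    (V : α → β → ℝ) (hV : V = fun a b => Y.fd 1 (fun _ => (a, b))) (T : ℕ) :
    klDiv (Y.fd T) (hmmFD M (fun ℓ m => N ℓ m / M ℓ) (fun ℓ i => V ℓ i / M ℓ) T) ≤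
      klDiv (Y.fd T) (hmmFD M P' W' T) := by
  have hMV : ∀ a, M a = ∑ b, V a b := fun a => by rw [hM, hV]
  have hV0 : ∀ a b, 0 ≤ V a b := fun a b => by rw [hV]; exact Y.nonneg _ _
  have hM0 : ∀ a, 0 ≤ M a := fun a => by rw [hMV]; exact Finset.sum_nonneg fun b _ => hV0 a b
  have mX : ∀ (R : α → β → ℝ) (i : Fin T), ∑ z, Y.fd T z * R (z i).1 (z i).2 =
      ∑ a, ∑ b, V a b * R a b := fun R i => by rw [hV]; exact margX Y R T i
  have mXX : ∀ (R : α → α → ℝ) (i : Fin T), (i : ℕ) ≠ 0 → ∑ z, Y.fd T z *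
      R (z ⟨(i : ℕ) - 1, lt_of_le_of_lt (Nat.sub_le _ _) i.isLt⟩).1 (z i).1 =
      ∑ a, ∑ c, N a c * R a c := fun R i h => by rw [hN]; exact margXX Y R T i h
  have hsum : ∑ a, M a = 1 := by
    have h1 := marg_one Y (fun _ => 1) 0 0 (by omega)
    have h2 := Y.sum_one 1
    simp only [mul_one, Fintype.sum_prod_type] at h1
    rw [hM]
    exact h1.symm.trans h2
  clear hM hV hN
  -- positivity
  have pV : ∀ z, 0 < Y.fd T z → ∀ i, 0 < V (z i).1 (z i).2 := by
    intro z hz i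
    have h := mX (fun a b => if a = (z i).1 ∧ b = (z i).2 then 1 else 0) i
    have h2 : ∑ a, ∑ b, V a b * (if a = (z i).1 ∧ b = (z i).2 then (1:ℝ) else 0)
        = V (z i).1 (z i).2 := by
      simp [ite_and]
    rw [← h2, ← h]
    refine lt_of_lt_of_le ?_ (Finset.single_le_sum (f := fun z' => Y.fd T z' *
      (if (z' i).1 = (z i).1 ∧ (z' i).2 = (z i).2 then (1:ℝ) else 0)) ?_ (Finset.mem_univ z))
    · simpa using hz
    · intro z' _; have := Y.nonneg T z'; positivity
  have pM : ∀ z, 0 < Y.fd T z → ∀ i, 0 < M (z i).1 := by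
    intro z hz i
    rw [hMV]
    exact lt_of_lt_of_le (pV z hz i) (Finset.single_le_sum (fun b _ => hV0 _ b) (Finset.mem_univ _))
  have pN : ∀ z, 0 < Y.fd T z → ∀ i : Fin T, (i : ℕ) ≠ 0 →
      0 < N (z ⟨(i : ℕ) - 1, lt_of_le_of_lt (Nat.sub_le _ _) i.isLt⟩).1 (z i).1 := by
    intro z hz i hi
    set j : Fin T := ⟨(i : ℕ) - 1, lt_of_le_of_lt (Nat.sub_le _ _) i.isLt⟩ with hj
    have h := mXX (fun a b => if a = (z j).1 ∧ b = (z i).1 then 1 else 0) i hi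
    have h2 : ∑ a, ∑ b, N a b * (if a = (z j).1 ∧ b = (z i).1 then (1:ℝ) else 0)
        = N (z j).1 (z i).1 := by
      simp [ite_and]
    rw [← h2, ← h]
    refine lt_of_lt_of_le ?_ (Finset.single_le_sum (f := fun z' => Y.fd T z' *
      (if (z' j).1 = (z j).1 ∧ (z' i).1 = (z i).1 then (1:ℝ) else 0)) ?_ (Finset.mem_univ z))
    · simpa using hz
    · intro z' _; have := Y.nonneg T z'; positivity
  -- factors
  let A : (α → α → ℝ) → (Fin T → α × β) → Fin T → ℝ := fun P z i =>
    if (i : ℕ) = 0 then M (z i).1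
    else P (z ⟨(i : ℕ) - 1, lt_of_le_of_lt (Nat.sub_le _ _) i.isLt⟩).1 (z i).1
  have hq : ∀ P W z, hmmFD M P W T z = (∏ i, A P z i) * ∏ i, W (z i).1 (z i).2 :=
    fun P W z => rfl
  set Ps : α → α → ℝ := fun ℓ m => N ℓ m / M ℓ with hPs
  set Ws : α → β → ℝ := fun ℓ i => V ℓ i / M ℓ with hWs
  have pA : ∀ z, 0 < Y.fd T z → ∀ i, 0 < A Ps z i := by
    intro z hz i
    by_cases h : (i : ℕ) = 0
    · simp only [A, h, if_true]; exact pM z hz i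
    · simp only [A, h, if_false, hPs]; exact div_pos (pN z hz i h) (pM z hz _)
  have pW : ∀ z, 0 < Y.fd T z → ∀ i, 0 < Ws (z i).1 (z i).2 := fun z hz i =>
    div_pos (pV z hz i) (pM z hz i)
  have pq : ∀ z, 0 < Y.fd T z → 0 < hmmFD M Ps Ws T z := fun z hz => by
    rw [hq]
    exact mul_pos (Finset.prod_pos fun i _ => pA z hz i) (Finset.prod_pos fun i _ => pW z hz i)
  have ac : ∀ z, hmmFD M Ps Ws T z = 0 → Y.fd T z = 0 := by
    intro z h
    by_contra h'
    exact (pq z (lt_of_le_of_ne (Y.nonneg T z) (Ne.symm h'))).ne' h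
  unfold klDiv
  rw [if_pos ac]
  split_ifs with ac'
  swap
  · exact le_top
  rw [EReal.coe_le_coe_iff, ← sub_nonpos, ← Finset.sum_sub_distrib]
  have nA : ∀ z i, 0 ≤ A P' z i := by
    intro z i
    simp only [A]; split_ifs
    · exact hM0 _
    · exact hP'0 _ _
  have key : ∀ z, Y.fd T z * Real.log (Y.fd T z / hmmFD M Ps Ws T z) -
      Y.fd T z * Real.log (Y.fd T z / hmmFD M P' W' T z) ≤
      ∑ i, Y.fd T z * (A P' z i / A Ps z i - 1) +
      ∑ i, Y.fd T z * (W' (z i).1 (z i).2 / Ws (z i).1 (z i).2 - 1) := by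
    intro z
    rcases (Y.nonneg T z).eq_or_lt with h | hz
    · simp [← h]
    have hne : hmmFD M P' W' T z ≠ 0 := fun h => hz.ne' (ac' z h)
    rw [Real.log_div hz.ne' hne, Real.log_div hz.ne' (pq z hz).ne']
    rw [hq] at hne
    obtain ⟨h1, h2⟩ := mul_ne_zero_iff.1 hne
    rw [hq, hq, Real.log_mul h1 h2, Real.log_mul (Finset.prod_pos fun i _ => pA z hz i).ne'
      (Finset.prod_pos fun i _ => pW z hz i).ne', ← Finset.mul_sum, ← Finset.mul_sum, ← mul_sub,
      ← mul_add]
    refine mul_le_mul_of_nonneg_left ?_ hz.le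
    have e1 := log_prod_sub_le (A Ps z) (A P' z) (pA z hz)
      (fun i => lt_of_le_of_ne (nA z i) (Ne.symm (Finset.prod_ne_zero_iff.1 h1 i (Finset.mem_univ i))))
    have e2 := log_prod_sub_le (fun i => Ws (z i).1 (z i).2) (fun i => W' (z i).1 (z i).2) (pW z hz)
      (fun i => lt_of_le_of_ne (hW'0 _ _)
        (Ne.symm (Finset.prod_ne_zero_iff.1 h2 i (Finset.mem_univ i))))
    linarith
  refine (Finset.sum_le_sum fun z _ => key z).trans ?_
  rw [Finset.sum_add_distrib, Finset.sum_comm, Finset.sum_comm (f := fun z i => Y.fd T z * (W' (z i).1 (z i).2 / Ws (z i).1 (z i).2 - 1))]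
  refine add_nonpos (Finset.sum_nonpos fun i _ => ?_) (Finset.sum_nonpos fun i _ => ?_)
  · by_cases h : (i : ℕ) = 0
    · refine Finset.sum_nonpos fun z _ => ?_
      simp only [A, h, if_true]
      exact mul_nonpos_of_nonneg_of_nonpos (Y.nonneg T z) (sub_nonpos.2 (div_self_le_one _))
    · simp only [A, h, if_false, mul_sub, mul_one, Finset.sum_sub_distrib, Y.sum_one]
      rw [mXX (fun a c => P' a c / Ps a c) i h, sub_nonpos]
      calc _ ≤ ∑ a, ∑ c, M a * P' a c := Finset.sum_le_sum fun a _ => Finset.sum_le_sum fun c _ =>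
            gibbs_term (hM0 a) (hP'0 a c)
        _ = 1 := by simp only [← Finset.mul_sum, hP'1, mul_one, hsum]
  · simp only [mul_sub, mul_one, Finset.sum_sub_distrib, Y.sum_one]
    rw [mX (fun a c => W' a c / Ws a c) i, sub_nonpos]
    calc _ ≤ ∑ a, ∑ c, M a * W' a c := Finset.sum_le_sum fun a _ => Finset.sum_le_sum fun c _ =>
            gibbs_term (hM0 a) (hW'0 a c)
      _ = 1 := by simp only [← Finset.mul_sum, hW'1, mul_one, hsum]

end HMM

/-- For a jointly stationary process `(Y_X, Y_O)` on `𝒳 × 𝒪`, among all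
hidden Markov models with initial state distribution `p_{Y_{X,1}}`, the KL divergence rate
to `(Y_X, Y_O)` is minimized by `P̃_{ℓ,m} = P(Y_{X,2} = m | Y_{X,1} = ℓ)` and
`W_{ℓ,i} = P(Y_{O,1} = i | Y_{X,1} = ℓ)`. -/
theorem hmm_aggregation_minimizes_KLDR
    {α β : Type*} [Fintype α] [Fintype β] (Y : StatProc (α × β))
    (P' : α → α → ℝ) (hP'0 : ∀ i j, 0 ≤ P' i j) (hP'1 : ∀ i, ∑ j, P' i j = 1)
    (W' : α → β → ℝ) (hW'0 : ∀ i o, 0 ≤ W' i o) (hW'1 : ∀ i, ∑ o, W' i o = 1) :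
    klRate Y.fd (hmmFD (fun a => ∑ b, Y.fd 1 (fun _ => (a, b))) P' W') ≥
      klRate Y.fd (hmmFD (fun a => ∑ b, Y.fd 1 (fun _ => (a, b)))
        (fun ℓ m => (∑ o₁, ∑ o₂, Y.fd 2 (fun k => if (k : ℕ) = 0 then (ℓ, o₁) else (m, o₂))) /
          (∑ b, Y.fd 1 (fun _ => (ℓ, b))))
        (fun ℓ i => Y.fd 1 (fun _ => (ℓ, i)) / (∑ b, Y.fd 1 (fun _ => (ℓ, b))))) := by
  refine Filter.limsup_le_limsup (Filter.Eventually.of_forall fun T => ?_)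
  refine mul_le_mul_of_nonneg_left ?_ (EReal.coe_nonneg.2 (by positivity))
  exact kl_le Y P' hP'0 hP'1 W' hW'0 hW'1 _ rfl _ rfl _ rfl T
end

section
/- Let X be a stationary, irreducible, aperiodic Markov chain on a finite state space 𝒳, let g : 𝒳 → 𝒴 be surjective onto the finite set 𝒴, and let Y_t = g(X_t). If the conditional entropy rate lim_{T→∞} (1/T) H(X_1^T | Y_1^T) equals 0, then for every T ∈ ℕ, H(X_1^T | Y_1^T) ≤ 2 log(|𝒳| − |𝒴| + 1). -/
open Classical

/-- Irreducibility of a transition matrix: every state reaches every state. -/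
def MCIrreducible {α : Type*} [Fintype α] [DecidableEq α] (P : Matrix α α ℝ) : Prop :=
  ∀ i j, ∃ n : ℕ, 0 < n ∧ 0 < (P ^ n) i j

/-- Aperiodicity of a transition matrix: for every state, returns are possible at all
sufficiently large times. -/
def MCAperiodic {α : Type*} [Fintype α] [DecidableEq α] (P : Matrix α α ℝ) : Prop :=
  ∀ i, ∃ N : ℕ, ∀ n, N ≤ n → 0 < (P ^ n) i i

/-- Shannon conditional entropy `H(A | B)` of a joint PMF `J` on `A × B`
(second argument is the conditioning variable). -/
noncomputable def condEnt2 {A B : Type*} [Fintype A] [Fintype B] (J : A → B → ℝ) : ℝ :=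
  -∑ a, ∑ b, J a b * Real.log (J a b / (∑ a', J a' b))

/-- Joint PMF of `(X_1^T, Y_1^T)` where `Y_t = g(X_t)` and `X` is the stationary Markov
chain with invariant distribution `π` and transition matrix `P`. -/
noncomputable def coarseJointMC {α γ : Type*} [Fintype α] [Fintype γ]
    (π : α → ℝ) (P : α → α → ℝ) (g : α → γ) (T : ℕ) :
    (Fin T → α) → (Fin T → γ) → ℝ :=
  fun x y => if ∀ i, y i = g (x i) then markovFD π P T x else 0

/-- Entropy of a weight `p` given the classes of a relation `r`. -/
noncomputable def relEnt {A : Type*} [Fintype A] (p : A → ℝ) (r : A → A → Prop) : ℝ :=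
  ∑ x, p x * Real.log ((∑ x', if r x x' then p x' else 0) / p x)

lemma le_relSum {A : Type*} [Fintype A] (p : A → ℝ) (hp : ∀ x, 0 ≤ p x) (r : A → A → Prop)
    (hr : ∀ x, r x x) (x : A) : p x ≤ ∑ x', if r x x' then p x' else 0 := by
  have := Finset.single_le_sum (f := fun x' => if r x x' then p x' else 0)
    (fun i _ => by split_ifs; exacts [hp i, le_rfl]) (Finset.mem_univ x)
  simpa [hr x] using this

lemma relEnt_term_nonneg {A : Type*} [Fintype A] (p : A → ℝ) (hp : ∀ x, 0 ≤ p x)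
    (r : A → A → Prop) (hr : ∀ x, r x x) (x : A) :
    0 ≤ p x * Real.log ((∑ x', if r x x' then p x' else 0) / p x) := by
  rcases (hp x).eq_or_lt with h | h
  · rw [← h]; simp
  · refine mul_nonneg (hp x) (Real.log_nonneg ?_)
    rw [le_div_iff₀ h, one_mul]
    exact le_relSum p hp r hr x

lemma relEnt_nonneg {A : Type*} [Fintype A] (p : A → ℝ) (hp : ∀ x, 0 ≤ p x)
    (r : A → A → Prop) (hr : ∀ x, r x x) : 0 ≤ relEnt p r :=
  Finset.sum_nonneg fun x _ => relEnt_term_nonneg p hp r hr x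

lemma relEnt_mono {A : Type*} [Fintype A] (p : A → ℝ) (hp : ∀ x, 0 ≤ p x)
    (r s : A → A → Prop) (hr : ∀ x, r x x) (hrs : ∀ x y, r x y → s x y) :
    relEnt p r ≤ relEnt p s := by
  refine Finset.sum_le_sum fun x _ => ?_
  rcases (hp x).eq_or_lt with h | h
  · rw [← h]; simp
  · have h1 := le_relSum p hp r hr x
    refine mul_le_mul_of_nonneg_left (Real.log_le_log (div_pos (lt_of_lt_of_le h h1) h) ?_) (hp x)
    gcongr with y _
    by_cases h2 : r x y
    · simp [h2, hrs x y h2]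
    · simp only [h2, if_false]
      split_ifs
      exacts [hp y, le_rfl]

lemma relEnt_eq_zero {A : Type*} [Fintype A] (p : A → ℝ) (hp : ∀ x, 0 ≤ p x)
    (r : A → A → Prop) (hr : ∀ x, r x x) (h0 : relEnt p r = 0) (x y : A) (hxy : r x y)
    (hx : 0 < p x) (hy : 0 < p y) : x = y := by
  by_contra hne
  have h1 := (Finset.sum_eq_zero_iff_of_nonneg
    (fun x _ => relEnt_term_nonneg p hp r hr x)).1 h0 x (Finset.mem_univ x)
  have h2 : p x + p y ≤ ∑ x', if r x x' then p x' else 0 := by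
    have := Finset.sum_le_univ_sum_of_nonneg (s := {x, y})
      (f := fun x' => if r x x' then p x' else 0)
      (fun i => by split_ifs; exacts [hp i, le_rfl])
    rw [Finset.sum_pair hne] at this
    simpa [hr x, hxy] using this
  have h3 : 0 < Real.log ((∑ x', if r x x' then p x' else 0) / p x) := by
    apply Real.log_pos
    rw [lt_div_iff₀ hx]
    linarith
  have := mul_pos hx h3
  linarith

lemma relEnt_le_log {A : Type*} [Fintype A] (p : A → ℝ) (hp : ∀ x, 0 ≤ p x)
    (hp1 : ∑ x, p x = 1)
    (r : A → A → Prop) (hr : ∀ x, r x x) (hsymm : ∀ x y, r x y → r y x) (N : ℝ) (hN : 1 ≤ N)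
    (hcard : ∀ x, ((Finset.univ.filter fun y => r x y ∧ 0 < p y).card : ℝ) ≤ N) :
    relEnt p r ≤ Real.log N := by
  have hN0 : 0 < N := by linarith
  have key : ∀ x, p x * Real.log ((∑ x', if r x x' then p x' else 0) / p x) ≤
      p x * Real.log N - p x +
        (∑ x', if r x x' ∧ 0 < p x then p x' else 0) / N := by
    intro x
    rcases (hp x).eq_or_lt with h | h
    · rw [← h]; simp
    · simp only [h, and_true]
      have h1 := le_relSum p hp r hr x
      set q := ∑ x', if r x x' then p x' else 0
      have hq : 0 < q := by linarith
      have h2 := Real.log_le_sub_one_of_pos (x := q / p x / N) (by positivity)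
      rw [Real.log_div (by positivity) (by positivity)] at h2
      have h3 : p x * (q / p x / N) = q / N := by field_simp
      nlinarith
  have hs : ∑ x, ∑ x', (if r x x' ∧ 0 < p x then p x' else 0) ≤ N := by
    rw [Finset.sum_comm]
    calc ∑ x', ∑ x, (if r x x' ∧ 0 < p x then p x' else 0)
        ≤ ∑ x', p x' * N := by
          refine Finset.sum_le_sum fun x' _ => ?_
          rw [← Finset.sum_filter, Finset.sum_const, nsmul_eq_mul, mul_comm]
          refine mul_le_mul_of_nonneg_left (le_trans ?_ (hcard x')) (hp x')
          exact_mod_cast Finset.card_le_card (fun y hy => by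
            simp only [Finset.mem_filter, Finset.mem_univ, true_and] at hy ⊢
            exact ⟨hsymm _ _ hy.1, hy.2⟩)
      _ = N := by rw [← Finset.sum_mul, hp1, one_mul]
  calc relEnt p r ≤ ∑ x, (p x * Real.log N - p x +
        (∑ x', if r x x' ∧ 0 < p x then p x' else 0) / N) :=
        Finset.sum_le_sum fun x _ => key x
    _ = Real.log N - 1 + (∑ x, ∑ x', (if r x x' ∧ 0 < p x then p x' else 0)) / N := by
        rw [Finset.sum_add_distrib, Finset.sum_sub_distrib, ← Finset.sum_mul, hp1,
          Finset.sum_div, one_mul]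
    _ ≤ Real.log N - 1 + 1 := by
        gcongr
        rwa [div_le_one hN0]
    _ = Real.log N := by ring

lemma markovFD_nonneg {α : Type*} [Fintype α] (μ : α → ℝ) (P : α → α → ℝ)
    (hμ : ∀ a, 0 ≤ μ a) (hP : ∀ a b, 0 ≤ P a b) (T : ℕ) (x : Fin T → α) :
    0 ≤ markovFD μ P T x := by
  refine Finset.prod_nonneg fun i _ => ?_
  split_ifs
  exacts [hμ _, hP _ _]

lemma markovFD_append {α : Type*} [Fintype α] (μ : α → ℝ) (P : α → α → ℝ)
    (t n : ℕ) (x : Fin (t + 1) → α) (b : Fin n → α) :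
    markovFD μ P (t + 1 + n) (Fin.append x b) =
      markovFD μ P (t + 1) x * markovFD (P (x (Fin.last t))) P n b := by
  unfold markovFD
  rw [Fin.prod_univ_add]
  congr 1
  · refine Finset.prod_congr rfl fun i _ => ?_
    have : (⟨((Fin.castAdd n i : Fin (t + 1 + n)) : ℕ) - 1,
      lt_of_le_of_lt (Nat.sub_le _ _) (Fin.castAdd n i).isLt⟩ : Fin (t + 1 + n)) =
      Fin.castAdd n ⟨(i : ℕ) - 1, lt_of_le_of_lt (Nat.sub_le _ _) i.isLt⟩ := by
      ext; simp
    rw [this]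
    simp only [Fin.append_left, Fin.val_castAdd]
  · refine Finset.prod_congr rfl fun i _ => ?_
    by_cases hi : (i : ℕ) = 0
    · have : (⟨((Fin.natAdd (t + 1) i : Fin (t + 1 + n)) : ℕ) - 1,
        lt_of_le_of_lt (Nat.sub_le _ _) (Fin.natAdd (t + 1) i).isLt⟩ : Fin (t + 1 + n)) =
        Fin.castAdd n (Fin.last t) := by
        ext; simp [hi]
      rw [this]
      simp only [Fin.append_left, Fin.append_right, Fin.val_natAdd, hi, if_true]
      simp
    · have : (⟨((Fin.natAdd (t + 1) i : Fin (t + 1 + n)) : ℕ) - 1,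
        lt_of_le_of_lt (Nat.sub_le _ _) (Fin.natAdd (t + 1) i).isLt⟩ : Fin (t + 1 + n)) =
        Fin.natAdd (t + 1) ⟨(i : ℕ) - 1, lt_of_le_of_lt (Nat.sub_le _ _) i.isLt⟩ := by
        ext; simp; omega
      rw [this]
      simp only [Fin.append_right, Fin.val_natAdd, hi, if_false]
      simp

lemma markovFD_cons {α : Type*} [Fintype α] (μ : α → ℝ) (P : α → α → ℝ)
    (n : ℕ) (a : α) (b : Fin n → α) :
    markovFD μ P (n + 1) (Fin.cons a b : Fin (n + 1) → α) = μ a * markovFD (P a) P n b := by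
  unfold markovFD
  rw [Fin.prod_univ_succ]
  congr 1
  refine Finset.prod_congr rfl fun i _ => ?_
  by_cases hi : (i : ℕ) = 0
  · have : (⟨((Fin.succ i : Fin (n + 1)) : ℕ) - 1,
      lt_of_le_of_lt (Nat.sub_le _ _) (Fin.succ i).isLt⟩ : Fin (n + 1)) = 0 := by
      ext; simp [hi]
    rw [this]
    simp [hi]
  · have : (⟨((Fin.succ i : Fin (n + 1)) : ℕ) - 1,
      lt_of_le_of_lt (Nat.sub_le _ _) (Fin.succ i).isLt⟩ : Fin (n + 1)) =
      Fin.succ ⟨(i : ℕ) - 1, lt_of_le_of_lt (Nat.sub_le _ _) i.isLt⟩ := by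
      ext; simp; omega
    rw [this]
    simp only [Fin.cons_succ, Fin.val_succ, Nat.succ_ne_zero, hi, if_false]

lemma sum_append {α : Type*} [Fintype α] (m n : ℕ) (f : (Fin (m + n) → α) → ℝ) :
    ∑ z, f z = ∑ x : Fin m → α, ∑ b : Fin n → α, f (Fin.append x b) := by
  rw [← Fintype.sum_prod_type' (f := fun (x : Fin m → α) (b : Fin n → α) => f (Fin.append x b))]
  exact ((Fin.appendEquiv m n).sum_comp f).symm

lemma sum_fin_one {α : Type*} [Fintype α] (f : (Fin 1 → α) → ℝ) :
    ∑ z, f z = ∑ a, f (fun _ => a) :=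
  ((Equiv.funUnique (Fin 1) α).symm.sum_comp f).symm

lemma markovFD_one {α : Type*} [Fintype α] (μ : α → ℝ) (P : α → α → ℝ) (a : α) :
    markovFD μ P 1 (fun _ => a) = μ a := by
  simp [markovFD]

lemma markovFD_sum {α : Type*} [Fintype α] (μ : α → ℝ) (P : α → α → ℝ)
    (hP1 : ∀ i, ∑ j, P i j = 1) (t : ℕ) :
    ∑ x, markovFD μ P (t + 1) x = ∑ a, μ a := by
  induction t with
  | zero =>
    rw [sum_fin_one]
    exact Finset.sum_congr rfl fun a _ => markovFD_one μ P a
  | succ t ih =>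
    rw [sum_append (t + 1) 1, ← ih]
    refine Finset.sum_congr rfl fun x _ => ?_
    simp only [markovFD_append, ← Finset.mul_sum]
    rw [sum_fin_one]
    simp only [markovFD_one, hP1, mul_one]

lemma markovFD_last {α : Type*} [Fintype α] (μ : α → ℝ) (P : α → α → ℝ)
    (hinv : ∀ j, ∑ i, μ i * P i j = μ j) (t : ℕ) (f : α → ℝ) :
    ∑ x, markovFD μ P (t + 1) x * f (x (Fin.last t)) = ∑ a, μ a * f a := by
  induction t generalizing f with
  | zero =>
    rw [sum_fin_one]
    exact Finset.sum_congr rfl fun a _ => congrArg (· * f a) (markovFD_one μ P a)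
  | succ t ih =>
    rw [sum_append (t + 1) 1]
    have h1 : ∀ (x : Fin (t + 1) → α) (b : Fin 1 → α),
        (Fin.append x b : Fin (t + 1 + 1) → α) (Fin.last (t + 1)) = b 0 := by
      intro x b
      exact Fin.append_right x b 0
    simp only [markovFD_append, sum_fin_one, markovFD_one, h1, mul_assoc, ← Finset.mul_sum]
    rw [ih (fun a => ∑ c, P a c * f c)]
    simp only [Finset.mul_sum]
    rw [Finset.sum_comm]
    refine Finset.sum_congr rfl fun c _ => ?_
    rw [← hinv c, Finset.sum_mul]
    exact Finset.sum_congr rfl fun a _ => by ring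

/-- Same image and same end state. -/
def endRel {α γ : Type*} (g : α → γ) (t : ℕ) (x y : Fin (t + 1) → α) : Prop :=
  (∀ i, g (x i) = g (y i)) ∧ x (Fin.last t) = y (Fin.last t)

lemma endRel_append {α γ : Type*} (g : α → γ) (t m : ℕ) (x x' : Fin (t + 1) → α)
    (b b' : Fin (m + 1) → α) (hx : endRel g t x x') (hb : endRel g m b b') :
    endRel g (t + 1 + m) (Fin.append x b : Fin (t + 1 + (m + 1)) → α)
      (Fin.append x' b' : Fin (t + 1 + (m + 1)) → α) := by
  refine ⟨fun i => ?_, ?_⟩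
  · refine Fin.addCases (m := t + 1) (n := m + 1) (fun i => ?_) (fun i => ?_) i
    · simpa only [Fin.append_left] using hx.1 i
    · simpa only [Fin.append_right] using hb.1 i
  · have h1 : ∀ (x : Fin (t + 1) → α) (b : Fin (m + 1) → α),
        (Fin.append x b : Fin (t + 1 + (m + 1)) → α) (Fin.last (t + 1 + m)) = b (Fin.last m) :=
      fun x b => Fin.append_right x b (Fin.last m)
    exact (h1 x b).trans (hb.2.trans (h1 x' b').symm)

lemma relEnt_step {α γ : Type*} [Fintype α] (π : α → ℝ) (P : α → α → ℝ)
    (hP0 : ∀ i j, 0 ≤ P i j) (hP1 : ∀ i, ∑ j, P i j = 1)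
    (hπ0 : ∀ i, 0 ≤ π i) (hinv : ∀ j, ∑ i, π i * P i j = π j) (g : α → γ) (t m : ℕ) :
    relEnt (markovFD π P (t + 1)) (endRel g t) +
      ∑ a, π a * relEnt (markovFD (P a) P (m + 1)) (endRel g m) ≤
    relEnt (markovFD π P (t + 1 + m + 1)) (endRel g (t + 1 + m)) := by
  have hp := markovFD_nonneg π P hπ0 hP0 (t + 1)
  have hK := fun a => markovFD_nonneg (P a) P (hP0 a) hP0 (m + 1)
  have e1 : relEnt (markovFD π P (t + 1)) (endRel g t) +
      ∑ a, π a * relEnt (markovFD (P a) P (m + 1)) (endRel g m) =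
      ∑ x : Fin (t + 1) → α, ∑ b : Fin (m + 1) → α,
        markovFD π P (t + 1) x * markovFD (P (x (Fin.last t))) P (m + 1) b *
        (Real.log ((∑ x', if endRel g t x x' then markovFD π P (t + 1) x' else 0) /
            markovFD π P (t + 1) x) +
          Real.log ((∑ b', if endRel g m b b' then
            markovFD (P (x (Fin.last t))) P (m + 1) b' else 0) /
            markovFD (P (x (Fin.last t))) P (m + 1) b)) := by
    rw [← markovFD_last π P hinv t
      (fun a => relEnt (markovFD (P a) P (m + 1)) (endRel g m))]
    unfold relEnt
    rw [← Finset.sum_add_distrib]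
    refine Finset.sum_congr rfl fun x _ => ?_
    simp only [mul_add, Finset.sum_add_distrib]
    congr 1
    · have := markovFD_sum (P (x (Fin.last t))) P hP1 m
      rw [hP1] at this
      rw [← Finset.sum_mul, ← Finset.mul_sum, this, mul_one]
    · rw [Finset.mul_sum]
      exact Finset.sum_congr rfl fun b _ => by ring
  rw [e1]
  unfold relEnt
  refine le_trans ?_ (sum_append (t + 1) (m + 1) _).ge
  refine Finset.sum_le_sum fun x _ => Finset.sum_le_sum fun b _ => ?_
  have e2 := markovFD_append π P t (m + 1) x b
  change _ ≤ markovFD π P (t + 1 + (m + 1)) (Fin.append x b) * Real.log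
    (_ / markovFD π P (t + 1 + (m + 1)) (Fin.append x b))
  rw [e2]
  rcases (hp x).eq_or_lt with h | h
  · rw [← h]; simp
  rcases (hK (x (Fin.last t)) b).eq_or_lt with h' | h'
  · rw [← h']; simp
  have l1 := le_relSum _ hp (endRel g t) (fun x => ⟨fun _ => rfl, rfl⟩) x
  have l2 := le_relSum _ (hK (x (Fin.last t))) (endRel g m) (fun x => ⟨fun _ => rfl, rfl⟩) b
  refine mul_le_mul_of_nonneg_left ?_ (mul_nonneg h.le h'.le)
  have q1 := lt_of_lt_of_le h l1
  have q2 := lt_of_lt_of_le h' l2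
  rw [← Real.log_mul (by positivity) (by positivity), div_mul_div_comm]
  refine Real.log_le_log (by positivity) ?_
  refine div_le_div_of_nonneg_right ?_ (mul_nonneg h.le h'.le)
  refine le_trans ?_ (sum_append (t + 1) (m + 1) _).ge
  rw [Finset.sum_mul_sum]
  refine Finset.sum_le_sum fun x' _ => Finset.sum_le_sum fun b' _ => ?_
  have e3 := markovFD_append π P t (m + 1) x' b'
  change _ ≤ if _ then markovFD π P (t + 1 + (m + 1)) (Fin.append x' b') else 0
  rw [e3]
  by_cases hx : endRel g t x x'
  · by_cases hb : endRel g m b b'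
    · rw [if_pos hx, if_pos hb, if_pos (endRel_append g t m x x' b b' hx hb), hx.2]
    · rw [if_neg hb, mul_zero]
      split_ifs
      exacts [mul_nonneg (hp _) (hK _ _), le_rfl]
  · rw [if_neg hx, zero_mul]
    split_ifs
    exacts [mul_nonneg (hp _) (hK _ _), le_rfl]

lemma condEnt2_eq {α γ : Type*} [Fintype α] [Fintype γ] (π : α → ℝ) (P : α → α → ℝ)
    (g : α → γ) (T : ℕ) :
    condEnt2 (coarseJointMC π P g T) =
      relEnt (markovFD π P T) (fun x y => ∀ i, g (x i) = g (y i)) := by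
  unfold condEnt2 relEnt
  rw [← Finset.sum_neg_distrib]
  refine Finset.sum_congr rfl fun x _ => ?_
  rw [Finset.sum_eq_single (fun i => g (x i))]
  · rw [← mul_neg, ← Real.log_inv, inv_div]
    simp [coarseJointMC]
    left
    congr!
  · intro y _ hy
    have : ¬ ∀ i, y i = g (x i) := fun h => hy (funext h)
    simp only [coarseJointMC, if_neg this, zero_mul]
  · intro h; exact absurd (Finset.mem_univ _) h

lemma fiber_card {α γ : Type*} [Fintype α] [Fintype γ] (g : α → γ) (hg : Function.Surjective g)
    (y : γ) : ((Finset.univ.filter fun a => g a = y).card : ℝ) ≤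
      (Fintype.card α : ℝ) - (Fintype.card γ : ℝ) + 1 := by
  have h1 : (Finset.univ.erase y).card ≤ (Finset.univ.filter fun a => ¬ g a = y).card := by
    refine (Finset.card_le_card (t := (Finset.univ.filter fun a => ¬ g a = y).image g) ?_).trans
      Finset.card_image_le
    intro z hz
    obtain ⟨a, rfl⟩ := hg z
    simp only [Finset.mem_erase, Finset.mem_univ, and_true] at hz
    exact Finset.mem_image_of_mem g (by simpa using hz)
  have h2 := Finset.card_filter_add_card_filter_not (s := (Finset.univ : Finset α))
    (fun a => g a = y)
  rw [Finset.card_univ] at h2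
  have h3 := Finset.card_erase_add_one (Finset.mem_univ y)
  rw [Finset.card_univ] at h3
  have h4 : (Finset.univ.filter fun a => g a = y).card + Fintype.card γ ≤
    Fintype.card α + 1 := by omega
  have h5 : ((Finset.univ.filter fun a => g a = y).card : ℝ) + Fintype.card γ ≤
    Fintype.card α + 1 := by exact_mod_cast h4
  linarith

lemma block_zero {α γ : Type*} [Fintype α] [Fintype γ] (π : α → ℝ) (P : α → α → ℝ)
    (hP0 : ∀ i j, 0 ≤ P i j) (hP1 : ∀ i, ∑ j, P i j = 1)
    (hπ0 : ∀ i, 0 ≤ π i) (hinv : ∀ j, ∑ i, π i * P i j = π j) (g : α → γ)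
    (hrate : Filter.Tendsto
      (fun T : ℕ => condEnt2 (coarseJointMC π P g T) / T) Filter.atTop (nhds 0)) (m : ℕ) :
    ∑ a, π a * relEnt (markovFD (P a) P (m + 1)) (endRel g m) = 0 := by
  set c := ∑ a, π a * relEnt (markovFD (P a) P (m + 1)) (endRel g m) with hc
  have hc0 : 0 ≤ c := Finset.sum_nonneg fun a _ => mul_nonneg (hπ0 a)
    (relEnt_nonneg _ (markovFD_nonneg (P a) P (hP0 a) hP0 (m + 1)) _ fun x => ⟨fun _ => rfl, rfl⟩)
  have hD : ∀ k : ℕ, k * c ≤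
      relEnt (markovFD π P (k * (m + 1) + 1)) (endRel g (k * (m + 1))) := by
    intro k
    induction k with
    | zero =>
      rw [Nat.cast_zero, zero_mul]
      exact relEnt_nonneg _ (markovFD_nonneg π P hπ0 hP0 _) _ fun x => ⟨fun _ => rfl, rfl⟩
    | succ k ih =>
      have := relEnt_step π P hP0 hP1 hπ0 hinv g (k * (m + 1)) m
      have e : (k + 1) * (m + 1) = k * (m + 1) + 1 + m := by ring
      rw [e]
      push_cast
      linarith
  have hle : ∀ k : ℕ, k * c / ((k * (m + 1) + 1 : ℕ) : ℝ) ≤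
      condEnt2 (coarseJointMC π P g (k * (m + 1) + 1)) / ((k * (m + 1) + 1 : ℕ) : ℝ) := by
    intro k
    refine div_le_div_of_nonneg_right ((hD k).trans ?_) (Nat.cast_nonneg _)
    rw [condEnt2_eq]
    exact relEnt_mono _ (markovFD_nonneg π P hπ0 hP0 _) _ _ (fun x => ⟨fun _ => rfl, rfl⟩)
      fun x y h => h.1
  have ht : Filter.Tendsto (fun k : ℕ => (k + 1) * (m + 1) + 1) Filter.atTop Filter.atTop := by
    refine Filter.tendsto_atTop_mono (fun k => ?_) Filter.tendsto_id
    simp only [id]; nlinarith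
  have h1 := hrate.comp ht
  have h2 : c / (m + 2) ≤ 0 := by
    refine ge_of_tendsto' h1 fun k => ?_
    refine le_trans ?_ (hle (k + 1))
    rw [div_le_div_iff₀ (by positivity) (by positivity)]
    push_cast
    have : (0 : ℝ) ≤ c * k := by positivity
    nlinarith
  have h3 : 0 < ((m : ℝ) + 2) := by positivity
  rw [div_le_iff₀ h3] at h2
  linarith

/-- If the information loss rate `lim_T H(X_1^T | Y_1^T)/T` of the coarse
graining `g` of a stationary irreducible aperiodic Markov chain vanishes, then the absolute
information loss is uniformly bounded: `H(X_1^T | Y_1^T) ≤ 2 log(|𝒳| − |𝒴| + 1)` for all `T`. -/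
theorem zero_loss_rate_implies_bounded_loss
    {α γ : Type*} [Fintype α] [DecidableEq α] [Fintype γ]
    (P : Matrix α α ℝ) (hP0 : ∀ i j, 0 ≤ P i j) (hP1 : ∀ i, ∑ j, P i j = 1)
    (hirr : MCIrreducible P) (hap : MCAperiodic P)
    (π : α → ℝ) (hπ0 : ∀ i, 0 ≤ π i) (hπ1 : ∑ i, π i = 1)
    (hinv : ∀ j, ∑ i, π i * P i j = π j)
    (g : α → γ) (hg : Function.Surjective g)
    (hrate : Filter.Tendsto
      (fun T : ℕ => condEnt2 (coarseJointMC π (fun a b => P a b) g T) / T)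
      Filter.atTop (nhds 0)) :
    ∀ T : ℕ, condEnt2 (coarseJointMC π (fun a b => P a b) g T) ≤
      2 * Real.log ((Fintype.card α : ℝ) - (Fintype.card γ : ℝ) + 1) := by
  have hp0 := markovFD_nonneg π (fun a b => P a b) hπ0 hP0
  have hz := block_zero π (fun a b => P a b) hP0 hP1 hπ0 hinv g hrate
  have hne : Nonempty α := by
    by_contra h
    rw [not_nonempty_iff] at h
    simp at hπ1
  set M : ℝ := (Fintype.card α : ℝ) - (Fintype.card γ : ℝ) + 1 with hM
  have hM1 : 1 ≤ M := by
    have : (Fintype.card γ : ℝ) ≤ Fintype.card α := by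
      exact_mod_cast Fintype.card_le_of_surjective g hg
    linarith
  have h2 : 2 * Real.log M = Real.log (M * M) := by
    rw [Real.log_mul (by positivity) (by positivity)]; ring
  have hMM : 1 ≤ M * M := by nlinarith
  intro T
  rw [condEnt2_eq, h2]
  cases T with
  | zero =>
    refine le_trans (le_of_eq ?_) (Real.log_nonneg hMM)
    simp [relEnt, markovFD]
  | succ t =>
    refine relEnt_le_log _ (hp0 _) ((markovFD_sum π _ hP1 t).trans hπ1) _ (fun x i => rfl)
      (fun x y h i => (h i).symm) _ hMM ?_
    intro x
    have hinj : Set.InjOn (fun z : Fin (t + 1) → α => (z 0, z (Fin.last t)))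
        ((Finset.univ.filter fun y => (∀ i, g (x i) = g (y i)) ∧
          0 < markovFD π (fun a b => P a b) (t + 1) y : Finset (Fin (t + 1) → α)) :
          Set (Fin (t + 1) → α)) := by
      intro y hy z hz' hyz
      simp only [Finset.coe_filter, Finset.mem_univ, true_and, Set.mem_ofPred_eq] at hy hz'
      simp only [Prod.mk.injEq] at hyz
      cases t with
      | zero =>
        funext i
        rw [Subsingleton.elim (α := Fin 1) i 0]
        exact hyz.1
      | succ m =>
        obtain ⟨⟨hy1, hy2⟩, hz1, hz2⟩ := And.intro hy hz'
        rw [← Fin.cons_self_tail y, markovFD_cons] at hy2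
        rw [← Fin.cons_self_tail z, markovFD_cons, ← hyz.1] at hz2
        have hK := markovFD_nonneg (P (y 0)) (fun a b => P a b) (hP0 (y 0)) hP0 (m + 1)
        have hpos : 0 < π (y 0) := by
          rcases (hπ0 (y 0)).eq_or_lt with h | h
          · rw [← h] at hy2; simp at hy2
          · exact h
        have h0 := (Finset.sum_eq_zero_iff_of_nonneg (fun a _ => mul_nonneg (hπ0 a)
          (relEnt_nonneg _ (markovFD_nonneg (P a) (fun a b => P a b) (hP0 a) hP0 (m + 1)) _
            fun x => ⟨fun _ => rfl, rfl⟩))).1 (hz m) (y 0) (Finset.mem_univ _)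
        have h0' := (mul_eq_zero.1 h0).resolve_left hpos.ne'
        have := relEnt_eq_zero _ hK (endRel g m) (fun x => ⟨fun _ => rfl, rfl⟩) h0'
          (Fin.tail y) (Fin.tail z)
          ⟨fun i => (hy1 i.succ).symm.trans (hz1 i.succ), hyz.2⟩
          (pos_of_mul_pos_right hy2 hpos.le) (pos_of_mul_pos_right hz2 hpos.le)
        rw [← Fin.cons_self_tail y, ← Fin.cons_self_tail z, this, hyz.1]
    have hc := Finset.card_le_card_of_injOn
      (t := (Finset.univ.filter fun a => g a = g (x 0)) ×ˢ
        (Finset.univ.filter fun a => g a = g (x (Fin.last t)))) _ (fun y hy => by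
        simp only [Finset.coe_filter, Finset.mem_univ, true_and, Set.mem_ofPred_eq] at hy
        simp only [Finset.coe_product, Finset.coe_filter, Finset.mem_univ, true_and,
          Set.mem_prod, Set.mem_ofPred_eq]
        exact ⟨(hy.1 _).symm, (hy.1 _).symm⟩) hinj
    rw [Finset.card_product] at hc
    have hc' := (Nat.cast_le (α := ℝ)).2 hc
    rw [Nat.cast_mul] at hc'
    refine le_trans (le_of_eq ?_) (hc'.trans (mul_le_mul (fiber_card g hg _) (fiber_card g hg _)
      (Nat.cast_nonneg _) (by linarith)))
    congr!
end

section
/- Fix a finite state space 𝒳 with |𝒳| = N and a surjective, non-injective function g : 𝒳 → 𝒴 with |𝒴| ≥ 2. Identify the set of row-stochastic N×N matrices with the product of N probability simplices, equipped with its natural Lebesgue measure. Then the set of irreducible aperiodic transition matrices P for which the coarse-grained process Y_t = g(X_t) of the associated stationary Markov chain X is a (first-order) Markov chain is a Lebesgue-null subset of the set of row-stochastic matrices; i.e., for a fixed non-injective coarse graining, the set of Markov chains lumpable with respect to it has measure zero. -/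
open Classical MeasureTheory

/-- PMF of `(Y_1, …, Y_T)` for `Y_t = g(X_t)`, `X` the stationary Markov chain `(π, P)`. -/
noncomputable def coarsePY {α Y : Type*} [Fintype α] (π : α → ℝ) (P : α → α → ℝ)
    (g : α → Y) (T : ℕ) (y : Fin T → Y) : ℝ :=
  ∑ x : Fin T → α, if ∀ i, g (x i) = y i then markovFD π P T x else 0

/-- Probability that coordinates `s, …, s+m-1` (0-based) of a `T`-dimensional PMF `pT`
agree with those of `y`. -/
noncomputable def seg {Y : Type*} [Fintype Y] {T : ℕ} (pT : (Fin T → Y) → ℝ)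
    (s m : ℕ) (y : Fin T → Y) : ℝ :=
  ∑ z : Fin T → Y,
    if ∀ i : Fin T, s ≤ (i : ℕ) → (i : ℕ) < s + m → z i = y i then pT z else 0

/-- Parametrization of row-stochastic `N × N` matrices by the product of `N` copies of the
`(N−1)`-dimensional coordinate chart of the probability simplex: the last entry of each
row is `1` minus the sum of the others. -/
noncomputable def toStoch (N : ℕ) (q : Fin N → Fin (N - 1) → ℝ) :
    Matrix (Fin N) (Fin N) ℝ :=
  Matrix.of fun i j => if h : (j : ℕ) < N - 1 then q i ⟨(j : ℕ), h⟩ else 1 - ∑ j', q i j'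

lemma sum_fin3 {α : Type*} [Fintype α] (f : (Fin 3 → α) → ℝ) :
    ∑ x, f x = ∑ a, ∑ b, ∑ c, f ![a, b, c] := by
  let e : α × α × α ≃ (Fin 3 → α) :=
    { toFun := fun p => ![p.1, p.2.1, p.2.2]
      invFun := fun x => (x 0, x 1, x 2)
      left_inv := fun p => by simp
      right_inv := fun x => by ext i; fin_cases i <;> simp }
  rw [← e.sum_comp, Fintype.sum_prod_type]
  simp_rw [Fintype.sum_prod_type]
  rfl

lemma seg_coarsePY {α Y : Type*} [Fintype α] [Fintype Y] (π : α → ℝ) (P : α → α → ℝ)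
    (g : α → Y) (T s m : ℕ) (y : Fin T → Y) :
    seg (coarsePY π P g T) s m y = ∑ x : Fin T → α,
      if ∀ i : Fin T, s ≤ (i : ℕ) → (i : ℕ) < s + m → g (x i) = y i
        then markovFD π P T x else 0 := by
  unfold seg coarsePY
  simp_rw [← Finset.sum_filter]
  rw [Finset.sum_sigma']
  refine Finset.sum_bij' (fun p _ => p.2) (fun x _ => ⟨fun i => g (x i), x⟩) ?_ ?_ ?_ ?_ ?_
  · rintro ⟨z, x⟩ h
    simp only [Finset.mem_sigma, Finset.mem_filter, Finset.mem_univ, true_and] at h ⊢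
    intro i h1 h2
    rw [h.2 i, h.1 i h1 h2]
  · intro x h
    simpa using h
  · rintro ⟨z, x⟩ h
    simp only [Finset.mem_sigma, Finset.mem_filter, Finset.mem_univ, true_and] at h ⊢
    have : (fun i => g (x i)) = z := funext h.2
    rw [this]
  · intro x h; rfl
  · rintro ⟨z, x⟩ h; rfl

lemma markovFD_three {α : Type*} [Fintype α] (π : α → ℝ) (P : α → α → ℝ) (a b c : α) :
    markovFD π P 3 ![a, b, c] = π a * P a b * P b c := by
  unfold markovFD
  rw [Fin.prod_univ_three]
  simp

/-- mass flowing from the cell `u` into `b` -/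
noncomputable def inFlow {α Y : Type*} [Fintype α] (π : α → ℝ) (P : α → α → ℝ)
    (g : α → Y) (u : Y) (b : α) : ℝ := ∑ a, if g a = u then π a * P a b else 0

/-- probability of going from `b` into the cell `u` -/
noncomputable def outProb {α Y : Type*} [Fintype α] (P : α → α → ℝ)
    (g : α → Y) (u : Y) (b : α) : ℝ := ∑ c, if g c = u then P b c else 0

lemma lump_three {α Y : Type*} [Fintype α] [Fintype Y] (π : α → ℝ) (P : α → α → ℝ)
    (g : α → Y) (u v : Y) (hrow : ∀ i, ∑ j, P i j = 1) (hstat : ∀ j, ∑ i, π i * P i j = π j)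
    (h : coarsePY π P g 3 ![u, v, u] * seg (coarsePY π P g 3) (3 - 2) 1 ![u, v, u]
      = seg (coarsePY π P g 3) (3 - 2) 2 ![u, v, u] *
        seg (coarsePY π P g 3) 0 (3 - 1) ![u, v, u]) :
    (∑ b, if g b = v then inFlow π P g u b * outProb P g u b else 0) *
      (∑ b, if g b = v then π b else 0) =
    (∑ b, if g b = v then π b * outProb P g u b else 0) *
      (∑ b, if g b = v then inFlow π P g u b else 0) := by
  rw [seg_coarsePY, seg_coarsePY, seg_coarsePY] at h
  unfold coarsePY at h
  simp only [sum_fin3, markovFD_three, Fin.forall_fin_succ] at h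
  simp at h
  convert! h using 2
  · rw [Finset.sum_comm]
    refine Finset.sum_congr rfl fun b _ => ?_
    by_cases hb : g b = v
    · simp only [hb, if_true, true_and, inFlow, outProb]
      rw [Finset.sum_mul]
      refine Finset.sum_congr rfl fun a _ => ?_
      by_cases ha : g a = u <;> simp [ha, Finset.mul_sum]
    · simp [hb]
  · rw [Finset.sum_comm]
    refine Finset.sum_congr rfl fun b _ => ?_
    by_cases hb : g b = v
    · simp [hb, ← Finset.mul_sum, hrow, hstat]
    · simp [hb]
  · rw [Finset.sum_comm]
    refine Finset.sum_congr rfl fun b _ => ?_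
    by_cases hb : g b = v
    · simp only [hb, if_true, true_and, outProb]
      rw [← hstat b, Finset.sum_mul]
      refine Finset.sum_congr rfl fun a _ => ?_
      simp [Finset.mul_sum]
    · simp [hb]
  · rw [Finset.sum_comm]
    refine Finset.sum_congr rfl fun b _ => ?_
    by_cases hb : g b = v
    · simp only [hb, if_true, inFlow]
      refine Finset.sum_congr rfl fun a _ => ?_
      by_cases ha : g a = u <;> simp [ha, ← Finset.mul_sum, hrow]
    · simp [hb]

open scoped ContDiff

def GoodNull (E : Type*) [NormedAddCommGroup E] [NormedSpace ℝ E] [MeasureSpace E] : Prop :=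
  ∀ f : E → ℝ, ContDiff ℝ ω f → (∃ x, f x ≠ 0) → volume {x | f x = 0} = 0

lemma goodNull_real : GoodNull ℝ := by
  intro f hf ⟨x, hx⟩
  have h1 := (contDiff_omega_iff_analyticOnNhd.1 hf).preimage_zero_mem_codiscrete hx
  have h2 := ae_restrict_le_codiscreteWithin (μ := (volume : Measure ℝ)) (U := Set.univ) MeasurableSet.univ h1
  rw [Measure.restrict_univ] at h2
  have h3 := mem_ae_iff.1 h2
  convert! h3 using 2
  ext; simp

lemma goodNull_prod {E F : Type*} [NormedAddCommGroup E] [NormedSpace ℝ E] [MeasureSpace E]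
    [BorelSpace E] [SecondCountableTopology E]
    [NormedAddCommGroup F] [NormedSpace ℝ F] [MeasureSpace F]
    [BorelSpace F] [SecondCountableTopology F] [SFinite (volume : Measure E)]
    [SFinite (volume : Measure F)]
    (hE : GoodNull E) (hF : GoodNull F) : GoodNull (E × F) := by
  intro f hf ⟨⟨x0, y0⟩, hx⟩
  have hm : MeasurableSet {x | f x = 0} := (isClosed_eq hf.continuous continuous_const).measurableSet
  rw [Measure.volume_eq_prod, Measure.measure_prod_null hm]
  have h1 := hE (fun x => f (x, y0)) (by fun_prop) ⟨x0, hx⟩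
  have h2 : ∀ᵐ x : E, f (x, y0) ≠ 0 := by
    rw [ae_iff]; simpa using h1
  filter_upwards [h2] with x hx
  exact hF (fun y => f (x, y)) (by fun_prop) ⟨y0, hx⟩

lemma goodNull_pi {E : Type*} [NormedAddCommGroup E] [NormedSpace ℝ E] [MeasureSpace E]
    [BorelSpace E] [SecondCountableTopology E] [SigmaFinite (volume : Measure E)]
    (hE : GoodNull E) (n : ℕ) : GoodNull (Fin n → E) := by
  induction n with
  | zero =>
    intro f hf ⟨x, hx⟩
    have : {x | f x = 0} = ∅ := by
      ext y; simp [Subsingleton.elim y x, hx]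
    rw [this, measure_empty]
  | succ n ih =>
    intro f hf ⟨x, hx⟩
    have hp := goodNull_prod hE ih
    have he := (volume_preserving_piFinSuccAbove (fun _ : Fin (n + 1) => E) 0)
    have hc : ContDiff ℝ ω (fun p : E × (Fin n → E) => (Fin.cons p.1 p.2 : Fin (n+1) → E)) := by
      rw [contDiff_pi]
      intro i
      refine Fin.cases ?_ (fun j => ?_) i
      · simp only [Fin.cons_zero]; fun_prop
      · simp only [Fin.cons_succ]; fun_prop
    have h := hp (fun p => f (Fin.cons p.1 p.2)) (hf.comp hc)
      ⟨(x 0, Fin.tail x), by simpa using hx⟩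
    have h2 := he.measure_preimage_equiv {p | f (Fin.cons p.1 p.2) = 0}
    rw [h] at h2
    convert! h2 using 2
    ext y
    simp [MeasurableEquiv.piFinSuccAbove, Fin.insertNthEquiv]

/-- perturbed generator -/
noncomputable def KMat (N : ℕ) (P : Matrix (Fin N) (Fin N) ℝ) : Matrix (Fin N) (Fin N) ℝ :=
  1 - P + Matrix.of (fun _ _ => (1 / N : ℝ))

/-- unnormalised stationary vector -/
noncomputable def vVec (N : ℕ) (P : Matrix (Fin N) (Fin N) ℝ) (j : Fin N) : ℝ :=
  ∑ i, (1 / N : ℝ) * (KMat N P).adjugate i j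

/-- the obstruction to lumpability -/
noncomputable def FObs {N M : ℕ} (g : Fin N → Fin M) (u v : Fin M) (π : Fin N → ℝ)
    (P : Matrix (Fin N) (Fin N) ℝ) : ℝ :=
  (∑ b, if g b = v then inFlow π P g u b * outProb P g u b else 0) *
      (∑ b, if g b = v then π b else 0) -
    (∑ b, if g b = v then π b * outProb P g u b else 0) *
      (∑ b, if g b = v then inFlow π P g u b else 0)

lemma vVec_eq {N : ℕ} (P : Matrix (Fin N) (Fin N) ℝ) (π : Fin N → ℝ) (hsum : ∑ i, π i = 1)
    (hstat : ∀ j, ∑ i, π i * P i j = π j) :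
    vVec N P = fun j => (KMat N P).det * π j := by
  have h1 : Matrix.vecMul π (KMat N P) = fun _ => (1 / N : ℝ) := by
    funext j
    simp only [Matrix.vecMul, dotProduct, KMat, Matrix.add_apply, Matrix.sub_apply, Matrix.of_apply,
      mul_add, mul_sub, Finset.sum_add_distrib, Finset.sum_sub_distrib, hstat, ← Finset.sum_mul,
      hsum, Matrix.one_apply]
    simp
  have h2 : Matrix.vecMul (Matrix.vecMul π (KMat N P)) (KMat N P).adjugate
      = (KMat N P).det • π := by
    rw [Matrix.vecMul_vecMul, Matrix.mul_adjugate, Matrix.vecMul_smul, Matrix.vecMul_one]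
  rw [h1] at h2
  funext j
  have := congrFun h2 j
  simpa [Matrix.vecMul, dotProduct, vVec] using this

lemma FObs_smul {N M : ℕ} (g : Fin N → Fin M) (u v : Fin M) (π : Fin N → ℝ)
    (P : Matrix (Fin N) (Fin N) ℝ) (c : ℝ) :
    FObs g u v (fun j => c * π j) P = c ^ 2 * FObs g u v π P := by
  have h1 : ∀ b, inFlow (fun j => c * π j) P g u b = c * inFlow π P g u b := by
    intro b
    simp only [inFlow, Finset.mul_sum, mul_ite, mul_zero, mul_assoc]
  simp only [FObs, h1]
  have h2 : ∀ f : Fin N → ℝ, (∑ b, if g b = v then c * f b else 0)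
      = c * ∑ b, if g b = v then f b else 0 := by
    intro f
    simp only [Finset.mul_sum, mul_ite, mul_zero]
  simp only [mul_assoc, h2]
  ring

lemma contDiff_toStoch (N : ℕ) (i j : Fin N) : ContDiff ℝ ω (fun q => toStoch N q i j) := by
  unfold toStoch
  simp only [Matrix.of_apply]
  split_ifs <;> fun_prop

lemma contDiff_vVec (N : ℕ) (j : Fin N) : ContDiff ℝ ω (fun q => vVec N (toStoch N q) j) := by
  unfold vVec
  refine ContDiff.sum fun i _ => ContDiff.mul contDiff_const ?_
  simp only [Matrix.adjugate_apply, Matrix.det_apply]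
  refine ContDiff.sum fun σ _ => ContDiff.const_smul _ (contDiff_prod fun k _ => ?_)
  simp only [Matrix.updateRow_apply]
  split_ifs
  · exact contDiff_const
  · simp only [KMat, Matrix.add_apply, Matrix.sub_apply, Matrix.of_apply]
    exact (contDiff_const.sub (contDiff_toStoch _ _ _)).add contDiff_const

lemma contDiff_ite_const {E : Type*} [NormedAddCommGroup E] [NormedSpace ℝ E] (p : Prop)
    {_ : Decidable p}
    (f : E → ℝ) (hf : ContDiff ℝ ω f) : ContDiff ℝ ω (fun x => if p then f x else 0) := by
  split_ifs
  · exact hf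
  · exact contDiff_const

lemma contDiff_FObs {N M : ℕ} (g : Fin N → Fin M) (u v : Fin M) :
    ContDiff ℝ ω (fun q => FObs g u v (vVec N (toStoch N q)) (toStoch N q)) := by
  have hv := contDiff_vVec N
  have hi : ∀ b, ContDiff ℝ ω
      (fun q => inFlow (vVec N (toStoch N q)) (toStoch N q) g u b) := fun b =>
    ContDiff.sum fun a _ => contDiff_ite_const _ _ ((hv a).mul (contDiff_toStoch N a b))
  have ho : ∀ b, ContDiff ℝ ω (fun q => outProb (toStoch N q) g u b) := fun b =>
    ContDiff.sum fun a _ => contDiff_ite_const _ _ (contDiff_toStoch N b a)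
  unfold FObs
  refine ContDiff.sub (ContDiff.mul ?_ ?_) (ContDiff.mul ?_ ?_) <;>
    refine ContDiff.sum fun b _ => contDiff_ite_const _ _ ?_
  · exact (hi b).mul (ho b)
  · exact hv b
  · exact (hv b).mul (ho b)
  · exact hi b

lemma toStoch_row (n : ℕ) (q : Fin (n + 1) → Fin (n + 1 - 1) → ℝ) (i : Fin (n + 1)) :
    ∑ j, toStoch (n + 1) q i j = 1 := by
  rw [Fin.sum_univ_castSucc]
  simp [toStoch]

lemma toStoch_surj (n : ℕ) (P : Matrix (Fin (n + 1)) (Fin (n + 1)) ℝ)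
    (hP : ∀ i, ∑ j, P i j = 1) : ∃ q, toStoch (n + 1) q = P := by
  refine ⟨fun i j => P i (Fin.castSucc j), ?_⟩
  ext i j
  refine Fin.lastCases ?_ (fun k => ?_) j
  · have := hP i
    rw [Fin.sum_univ_castSucc] at this
    simp only [toStoch, Matrix.of_apply, Fin.val_last, Nat.add_sub_cancel, lt_irrefl, dite_false]
    exact sub_eq_of_eq_add' this.symm
  · simp [toStoch]

lemma witness {N M : ℕ} (g : Fin N → Fin M) (a1 a2 b0 : Fin N) (h12 : a1 ≠ a2)
    (hg : g a1 = g a2) (hb : g b0 ≠ g a1) :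
    ∃ P : Matrix (Fin N) (Fin N) ℝ, (∀ i, ∑ j, P i j = 1) ∧
      FObs g (g b0) (g a1) (vVec N P) P ≠ 0 := by
  have hab : a1 ≠ b0 := fun h => hb (by rw [h])
  have hN : (N : ℝ) ≠ 0 := by
    have := a1.pos
    positivity
  set w : Fin N → ℝ := fun i => (if i = a1 then 1 else 0) - (if i = b0 then 1 else 0) with hw
  have hws : ∑ i, w i = 0 := by simp [hw, Finset.sum_sub_distrib]
  have hwb : ∑ i, (if g i = g b0 then w i else 0) = -1 := by
    have : ∀ i, (if g i = g b0 then w i else 0) = -(if i = b0 then 1 else 0) := by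
      intro i
      by_cases h1 : i = a1
      · subst h1; simp [hab, Ne.symm hb]
      · by_cases h2 : i = b0 <;> simp [hw, h1, h2]
        intro h; exact absurd h (Ne.symm hab)
    simp [this]
  have hwa' : ∀ i, (if g i = g a1 then w i else 0) = (if i = a1 then 1 else 0) := by
      intro i
      by_cases h1 : i = b0
      · subst h1; simp [Ne.symm hab, hb]
      · by_cases h2 : i = a1 <;> simp [hw, h1, h2, hab]
  have hwa : ∑ i, (if g i = g a1 then w i else 0) = 1 := by
    simp [hwa']
  have hw2 : ∀ i, (if g i = g a1 then w i * w i else 0) = (if i = a1 then 1 else 0) := by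
    intro i
    have := hwa' i
    by_cases h : g i = g a1
    · simp only [h, if_true] at this ⊢
      rw [this]; simp
    · simp only [h, if_false] at this ⊢
      exact this
  have hwa2 : ∑ i, (if g i = g a1 then w i * w i else 0) = 1 := by
    simp [hw2]
  have hww : ∑ i, w i * w i = 2 := by
    have : ∀ i, w i * w i = (if i = a1 then 1 else 0) + (if i = b0 then 1 else 0) := by
      intro i
      by_cases h1 : i = a1
      · simp [hw, h1, hab]
      · by_cases h2 : i = b0 <;> simp [hw, h1, h2, Ne.symm hab]
    simp [this, Finset.sum_add_distrib]; norm_num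
  set P : Matrix (Fin N) (Fin N) ℝ := Matrix.of fun i j => 1 / (N : ℝ) + w i * w j with hP
  have hrow : ∀ i, ∑ j, P i j = 1 := by
    intro i
    simp [hP, Finset.sum_add_distrib, ← Finset.mul_sum, hws, hN]
  have hcol : ∀ j, ∑ i, P i j = 1 := by
    intro j
    simp [hP, Finset.sum_add_distrib, ← Finset.sum_mul, hws, hN]
  have hv : vVec N P = fun j => (KMat N P).det * (1 / N : ℝ) := by
    refine vVec_eq P (fun _ => 1 / N) (by simp [hN]) ?_
    intro j
    rw [← Finset.mul_sum, hcol, mul_one]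
  have hK : KMat N P * KMat N P = 1 := by
    have hK1 : KMat N P = 1 - Matrix.vecMulVec w w := by
      ext i j
      simp [KMat, hP, Matrix.vecMulVec_apply]
      ring
    rw [hK1]
    have : Matrix.vecMulVec w w * Matrix.vecMulVec w w = (2 : ℝ) • Matrix.vecMulVec w w := by
      ext i j
      simp only [Matrix.mul_apply, Matrix.vecMulVec_apply, Matrix.smul_apply, smul_eq_mul]
      rw [← hww, Finset.sum_mul]
      refine Finset.sum_congr rfl fun k _ => by ring
    rw [sub_mul, mul_sub, mul_sub, this, two_smul]
    simp
  have hdet : (KMat N P).det ≠ 0 := by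
    intro h
    have := congrArg Matrix.det hK
    simp [h] at this
  refine ⟨P, hrow, ?_⟩
  rw [hv, FObs_smul]
  refine mul_ne_zero (pow_ne_zero _ hdet) ?_
  rw [show (fun _ : Fin N => (1 / N : ℝ)) = fun _ => (1 / N : ℝ) * (fun _ : Fin N => (1 : ℝ)) a1
    by simp]
  have hone := FObs_smul g (g b0) (g a1) (fun _ => 1) P (1 / N)
  rw [hone]
  refine mul_ne_zero (by positivity) ?_
  set s : ℝ := ∑ c, (if g c = g b0 then 1 / (N : ℝ) else 0) with hs
  have hin : ∀ b, inFlow (fun _ => 1) P g (g b0) b = s - w b := by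
    intro b
    have : ∀ c, (if g c = g b0 then (1 : ℝ) * P c b else 0) =
        (if g c = g b0 then 1 / (N : ℝ) else 0) + (if g c = g b0 then w c else 0) * w b := by
      intro c; split_ifs <;> simp [hP]
    simp only [inFlow, this, Finset.sum_add_distrib, ← Finset.sum_mul, hwb, ← hs]
    ring
  have hout : ∀ b, outProb P g (g b0) b = s - w b := by
    intro b
    have : outProb P g (g b0) b = ∑ c, ((if g c = g b0 then 1 / (N : ℝ) else 0) +
        (if g c = g b0 then w c else 0) * w b) := by
      refine Finset.sum_congr rfl fun c _ => ?_
      by_cases h : g c = g b0 <;> simp [h, hP, mul_comm]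
    simp only [this, Finset.sum_add_distrib, ← Finset.sum_mul, hwb, ← hs]
    ring
  set n : ℝ := ∑ c, (if g c = g a1 then (1 : ℝ) else 0) with hn
  have hn2 : 2 ≤ n := by
    rw [hn, ← Finset.sum_filter, Finset.sum_const, nsmul_eq_mul, mul_one]
    have : ({a1, a2} : Finset (Fin N)) ⊆ Finset.univ.filter (fun c => g c = g a1) := by
      intro x hx
      simp only [Finset.mem_insert, Finset.mem_singleton] at hx
      rcases hx with rfl | rfl <;> simp [hg]
    have h := Finset.card_le_card this
    rw [Finset.card_pair h12] at h
    exact_mod_cast h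
  have e1 : (∑ b, if g b = g a1 then (s - w b) else 0) = s * n - 1 := by
    have : ∀ b, (if g b = g a1 then (s - w b) else 0) =
        s * (if g b = g a1 then 1 else 0) - (if g b = g a1 then w b else 0) := by
      intro b; split_ifs <;> simp
    simp only [this, Finset.sum_sub_distrib, ← Finset.mul_sum, hwa, ← hn]
  have e2 : (∑ b, if g b = g a1 then (s - w b) * (s - w b) else 0) = s ^ 2 * n - 2 * s + 1 := by
    have : ∀ b, (if g b = g a1 then (s - w b) * (s - w b) else 0) =
        s ^ 2 * (if g b = g a1 then 1 else 0) - 2 * s * (if g b = g a1 then w b else 0)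
          + (if g b = g a1 then w b * w b else 0) := by
      intro b; split_ifs
      · ring
      · ring
    simp only [this, Finset.sum_sub_distrib, Finset.sum_add_distrib, ← Finset.mul_sum, hwa, hwa2,
      ← hn]
    ring
  simp only [FObs, hin, hout, one_mul, e1, e2, ← hn]
  intro h
  nlinarith

/-- For a fixed surjective non-injective coarse graining
`g : [N] → [M]`, `M ≥ 2`, the set of irreducible aperiodic row-stochastic matrices whose
associated stationary Markov chain is lumpable w.r.t. `g` (i.e. the coarse-grained process
`Y_t = g(X_t)` is a first-order Markov chain, expressed in cross-multiplied form) is a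
Lebesgue-null set in the natural simplex-product parametrization. -/
theorem lumpable_chains_form_null_set
    (N M : ℕ) (hM : 2 ≤ M) (g : Fin N → Fin M)
    (hsurj : Function.Surjective g) (hnoninj : ¬ Function.Injective g) :
    volume {q : Fin N → Fin (N - 1) → ℝ |
      (∀ i j, 0 ≤ toStoch N q i j) ∧
      MCIrreducible (toStoch N q) ∧ MCAperiodic (toStoch N q) ∧
      ∃ π : Fin N → ℝ, (∀ i, 0 ≤ π i) ∧ (∑ i, π i = 1) ∧
        (∀ j, ∑ i, π i * toStoch N q i j = π j) ∧
        (∀ t : ℕ, 1 < t → ∀ y : Fin t → Fin M,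
          coarsePY π (fun a b => toStoch N q a b) g t y
              * seg (coarsePY π (fun a b => toStoch N q a b) g t) (t - 2) 1 y
            = seg (coarsePY π (fun a b => toStoch N q a b) g t) (t - 2) 2 y
              * seg (coarsePY π (fun a b => toStoch N q a b) g t) 0 (t - 1) y)} = 0 := by
  obtain ⟨a1, a2, hg, h12⟩ : ∃ a1 a2, g a1 = g a2 ∧ a1 ≠ a2 := by
    simpa [Function.Injective] using hnoninj
  obtain ⟨u, hu⟩ : ∃ u : Fin M, u ≠ g a1 := by
    have : Nontrivial (Fin M) := Fin.nontrivial_iff_two_le.2 hM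
    exact exists_ne _
  obtain ⟨b0, rfl⟩ := hsurj u
  obtain ⟨P, hP, hF⟩ := witness g a1 a2 b0 h12 hg hu
  obtain ⟨n, rfl⟩ : ∃ n, N = n + 1 := ⟨N - 1, by have := a1.pos; omega⟩
  obtain ⟨q0, hq0⟩ := toStoch_surj n P hP
  have hnull := goodNull_pi (goodNull_pi goodNull_real (n + 1 - 1)) (n + 1) _
    (contDiff_FObs g (g b0) (g a1)) ⟨q0, by rw [hq0]; exact hF⟩
  refine measure_mono_null ?_ hnull
  rintro q ⟨_, _, _, π, _, hsum, hstat, hl⟩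
  have h3 := lump_three π (fun a b => toStoch (n + 1) q a b) g (g b0) (g a1)
    (toStoch_row n q) hstat (hl 3 (by norm_num) _)
  show FObs _ _ _ _ _ = 0
  rw [vVec_eq _ π hsum hstat, FObs_smul]
  have h4 : FObs g (g b0) (g a1) π (toStoch (n + 1) q) = 0 := by
    unfold FObs
    refine sub_eq_zero.2 ?_
    convert! h3 using 2 <;>
      (refine Finset.sum_congr rfl fun b _ => ?_
       by_cases h : g b = g a1
       · rw [if_pos h, if_pos h]
       · rw [if_neg h, if_neg h])
  rw [h4, mul_zero]
end
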